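/- arXiv:1607.07958 — 2 statements merged into one kernel-verified Lean document; each statement's English description precedes it below -/
import Mathlib

section
/- (Optimality, necessity of the homogeneous half derivative.) Let d ≥ 2 and α₁, α₂ ≥ 0 with α₁ + α₂ > (d−1)/2. If α̃ < 1/2, then for every α₀ ≥ 0 the Strichartz estimate ‖ |∇|^{α̃} ρ_{e^{itΔ} γ₀ e^{−itΔ}} ‖_{L²_t(ℝ; H^{α₀}_x)} ≤ C ‖⟨∇⟩^{α₁} γ₀ ⟨∇⟩^{α₂}‖_{𝔖²} fails: there is no finite constant C making it hold for all Hilbert–Schmidt operators γ₀ on L²(ℝ^d). In particular, the dual norm evaluated on the low-frequency test functions Ṽ_n(τ,ξ) = n^{(d+2)/2} 𝟙_{[−1/n², 1/n²]}(τ) 𝟙_{B(0,1/n)}(ξ) is comparable to n^{(1−2α̃)/2} → ∞ while ‖Ṽ_n‖_{L²_{τ,ξ}} ≈ 1. -/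
open MeasureTheory Complex Filter
open scoped ENNReal NNReal RealInnerProductSpace Topology ComplexConjugate

noncomputable section

/-- `d`-dimensional Euclidean space `ℝ^d`. -/
abbrev Vd (d : ℕ) := EuclideanSpace ℝ (Fin d)

/-- The Japanese bracket `⟨ξ⟩ = (1 + |ξ|²)^{1/2}`. -/
noncomputable def jb {d : ℕ} (ξ : Vd d) : ℝ := (1 + ‖ξ‖ ^ 2) ^ ((1 : ℝ) / 2)

/-- Fourier transform, with the paper's convention `ĥ(ξ) = ∫ e^{-i x·ξ} h(x) dx`. -/
noncomputable def ft {d : ℕ} (h : Vd d → ℂ) (ξ : Vd d) : ℂ :=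
  ∫ x : Vd d, Complex.exp (-(Complex.I * Complex.ofReal (⟪x, ξ⟫))) * h x

/-- Inverse Fourier transform `ǧ(x) = (2π)^{-d} ∫ e^{i x·ξ} g(ξ) dξ`. -/
noncomputable def invFt {d : ℕ} (h : Vd d → ℂ) (x : Vd d) : ℂ :=
  (((2 * Real.pi) ^ d)⁻¹ : ℝ) • ∫ ξ : Vd d, Complex.exp (Complex.I * Complex.ofReal (⟪x, ξ⟫)) * h ξ

/-- The space Fourier transform (at frequency `ξ`, time `t`) of the density of
`e^{itΔ} γ₀ e^{-itΔ}`, expressed via `G = γ̂₀`, the `2d`-dimensional Fourier transform of the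
integral kernel of `γ₀`:  `ρ̂(t,ξ) = (2π)^{-d} ∫ e^{-it(|η|²-|ξ-η|²)} G(η, ξ-η) dη`. -/
noncomputable def densFT {d : ℕ} (G : Vd d × Vd d → ℂ) (t : ℝ) (ξ : Vd d) : ℂ :=
  (((2 * Real.pi) ^ d)⁻¹ : ℝ) •
    ∫ η : Vd d, Complex.exp (-(Complex.I * Complex.ofReal (t * (‖η‖ ^ 2 - ‖ξ - η‖ ^ 2)))) * G (η, ξ - η)

/-- `‖ |∇|^s ρ_{e^{itΔ}γ₀e^{-itΔ}} ‖_{L²_t(ℝ; H^{α₀}_x)}`, computed on the space Fourier side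
(by Plancherel) from `G = γ̂₀`. -/
noncomputable def densStriNorm {d : ℕ} (s α₀ : ℝ) (G : Vd d × Vd d → ℂ) : ℝ≥0∞ :=
  (∫⁻ t : ℝ, ∫⁻ ξ : Vd d,
      ENNReal.ofReal (‖ξ‖ ^ (2 * s) * jb ξ ^ (2 * α₀)) * (‖densFT G t ξ‖₊ : ℝ≥0∞) ^ (2:ℝ)) ^ ((1:ℝ)/2)

/-- The weighted Hilbert–Schmidt norm `‖⟨∇⟩^{α₁} γ₀ ⟨∇⟩^{α₂}‖_{𝔖²}`, computed (by Plancherel)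
from `G = γ̂₀`. -/
noncomputable def wHSnorm {d : ℕ} (α₁ α₂ : ℝ) (G : Vd d × Vd d → ℂ) : ℝ≥0∞ :=
  (∫⁻ p : Vd d × Vd d,
      ENNReal.ofReal (jb p.1 ^ (2 * α₁) * jb p.2 ^ (2 * α₂)) * (‖G p‖₊ : ℝ≥0∞) ^ (2:ℝ)) ^ ((1:ℝ)/2)

/-- The dual weighted norm
`‖ |ξ|^{s} ⟨ξ⟩^{α₀} Ṽ(-|η|²+|ξ-η|², ξ) / (⟨η⟩^{α₁} ⟨ξ-η⟩^{α₂}) ‖_{L²_ξ L²_η}`,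
where `W = Ṽ` is the space-time Fourier transform of `V` (here `q = (ξ, η)`). -/
noncomputable def dualStriNorm {d : ℕ} (s α₀ α₁ α₂ : ℝ) (W : ℝ × Vd d → ℂ) : ℝ≥0∞ :=
  (∫⁻ q : Vd d × Vd d,
      ENNReal.ofReal
        ((‖q.1‖ ^ (2 * s) * jb q.1 ^ (2 * α₀)) /
          (jb q.2 ^ (2 * α₁) * jb (q.1 - q.2) ^ (2 * α₂))) *
      (‖W (-‖q.2‖ ^ 2 + ‖q.1 - q.2‖ ^ 2, q.1)‖₊ : ℝ≥0∞) ^ (2:ℝ)) ^ ((1:ℝ)/2)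

/-- The `L²_{τ,ξ}` norm of a space-time (Fourier) function. -/
noncomputable def l2full {d : ℕ} (W : ℝ × Vd d → ℂ) : ℝ≥0∞ :=
  (∫⁻ z : ℝ × Vd d, (‖W z‖₊ : ℝ≥0∞) ^ (2:ℝ)) ^ ((1:ℝ)/2)

/-- The low-frequency test functions
`Ṽ_n(τ,ξ) = n^{(d+2)/2} 𝟙_{[-1/n², 1/n²]}(τ) 𝟙_{B(0,1/n)}(ξ)`. -/
noncomputable def lowFreqTest (d : ℕ) (n : ℕ) : ℝ × Vd d → ℂ := fun z =>
  (((n : ℝ) ^ (((d:ℝ) + 2) / 2) : ℝ) : ℂ) *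
    (if |z.1| ≤ 1 / (n:ℝ) ^ 2 ∧ ‖z.2‖ ≤ 1 / (n:ℝ) then 1 else 0)

/-- In the variables `(ξ, η)`: the frequencies with `|ξ| ∼ 1/n` and bounded `η` on which the
modulation `|η|² - |ξ-η|²` is at most `1/n²`. -/
def lowFreqSet (d n : ℕ) : Set (Vd d × Vd d) :=
  {q | 1 / (2 * (n:ℝ)) ≤ ‖q.1‖ ∧ ‖q.1‖ ≤ 1 / (n:ℝ) ∧ ‖q.2‖ ≤ 5 ∧
    |‖q.2‖ ^ 2 - ‖q.1 - q.2‖ ^ 2| ≤ 1 / (n:ℝ) ^ 2}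

lemma measurableSet_lowFreqSet (d n : ℕ) : MeasurableSet (lowFreqSet d n) := by
  have h1 : Measurable fun q : Vd d × Vd d => ‖q.1‖ := by fun_prop
  have h2 : Measurable fun q : Vd d × Vd d => ‖q.2‖ := by fun_prop
  have h3 : Measurable fun q : Vd d × Vd d => |‖q.2‖ ^ 2 - ‖q.1 - q.2‖ ^ 2| := by
    exact (by fun_prop : Continuous fun q : Vd d × Vd d =>
      |‖q.2‖ ^ 2 - ‖q.1 - q.2‖ ^ 2|).measurable
  exact (measurableSet_le measurable_const h1).inter ((measurableSet_le h1 measurable_const).inter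
    ((measurableSet_le h2 measurable_const).inter (measurableSet_le h3 measurable_const)))

lemma volume_lowFreqSet_lt_top (d n : ℕ) :
    volume (lowFreqSet d n) < ⊤ := by
  refine lt_of_le_of_lt (measure_mono (t := Metric.closedBall 0 (1 / (n:ℝ)) ×ˢ
    Metric.closedBall 0 5) ?_) ?_
  · rintro q ⟨-, h2, h3, -⟩
    simp only [Set.mem_prod, mem_closedBall_zero_iff]
    exact ⟨h2, h3⟩
  · exact ((isCompact_closedBall _ _).prod (isCompact_closedBall _ _)).measure_lt_top

lemma one_le_jb {d : ℕ} (ξ : Vd d) : 1 ≤ jb ξ :=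
  Real.one_le_rpow (by nlinarith [sq_nonneg ‖ξ‖]) (by norm_num)

lemma jb_le {d : ℕ} {ξ : Vd d} (h : ‖ξ‖ ≤ 6) : jb ξ ≤ 7 := by
  rw [jb, ← Real.sqrt_eq_rpow]
  exact Real.sqrt_le_iff.2 ⟨by norm_num, by nlinarith [norm_nonneg ξ]⟩

/-- Integer translates of a section of `lowFreqSet` cover the unit ball. -/
lemma volume_ball_le_section (d : ℕ) {n : ℕ} (hn : 1 ≤ n) {ξ : Vd d}
    (h1 : 1 / (2 * (n:ℝ)) ≤ ‖ξ‖) (h2 : ‖ξ‖ ≤ 1 / (n:ℝ)) :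
    volume (Metric.ball (0 : Vd d) 1) ≤
      ENNReal.ofReal (5 * n) * volume (Prod.mk ξ ⁻¹' lowFreqSet d n) := by
  have hn' : (1:ℝ) ≤ n := by exact_mod_cast hn
  have hn0 : (0:ℝ) < n := by linarith
  have hξ : 0 < ‖ξ‖ := lt_of_lt_of_le (by positivity) h1
  set v : Vd d := (1 / ((n:ℝ) ^ 2 * ‖ξ‖ ^ 2)) • ξ with hv
  have hnξ1 : 1 ≤ 2 * n * ‖ξ‖ := by
    rw [div_le_iff₀ (by positivity)] at h1; linarith
  have hnξ2 : n * ‖ξ‖ ≤ 1 := by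
    rw [le_div_iff₀ (by positivity)] at h2; linarith
  have hvn : ‖v‖ ≤ 2 / n := by
    rw [hv, norm_smul, Real.norm_of_nonneg (by positivity), le_div_iff₀ hn0]
    have : 1 / ((n:ℝ) ^ 2 * ‖ξ‖ ^ 2) * ‖ξ‖ * n = 1 / (n * ‖ξ‖) := by
      field_simp
    rw [this, div_le_iff₀ (by positivity)]; linarith
  have hiv : ⟪ξ, v⟫ = 1 / (n:ℝ) ^ 2 := by
    rw [hv, real_inner_smul_right, real_inner_self_eq_norm_sq]; field_simp
  have hcov : Metric.ball (0 : Vd d) 1 ⊆ ⋃ k ∈ Finset.Icc (-(n:ℤ) - 1) (n + 1),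
      (fun y => y + (-(k:ℝ)) • v) ⁻¹' (Prod.mk ξ ⁻¹' lowFreqSet d n) := by
    intro x hx
    rw [mem_ball_zero_iff] at hx
    set r : ℝ := (2 * ⟪ξ, x⟫ - ‖ξ‖ ^ 2) * n ^ 2 / 2 with hr
    have hkr := abs_sub_round r
    have hin : |⟪ξ, x⟫| ≤ ‖ξ‖ :=
      (abs_real_inner_le_norm ξ x).trans (by nlinarith)
    have hr1 : |r| ≤ n + 1 / 2 := by
      have e : |r| = |2 * ⟪ξ, x⟫ - ‖ξ‖ ^ 2| * n ^ 2 / 2 := by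
        rw [hr, abs_div, abs_mul, abs_of_nonneg (by positivity : (0:ℝ) ≤ n ^ 2)]; norm_num
      have e2 : |2 * ⟪ξ, x⟫ - ‖ξ‖ ^ 2| ≤ 2 * ‖ξ‖ + ‖ξ‖ ^ 2 := by
        rw [abs_le] at hin ⊢
        constructor <;> nlinarith [sq_nonneg ‖ξ‖]
      have e3 : |2 * ⟪ξ, x⟫ - ‖ξ‖ ^ 2| * n ^ 2 ≤ (2 * ‖ξ‖ + ‖ξ‖ ^ 2) * n ^ 2 := by gcongr
      have e4 : (n * ‖ξ‖) ^ 2 ≤ 1 := by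
        have : 0 ≤ n * ‖ξ‖ := by positivity
        nlinarith
      rw [e]
      nlinarith
    have hk : |(round r : ℝ)| ≤ n + 1 := by
      have := abs_sub_abs_le_abs_sub (round r : ℝ) r
      rw [abs_sub_comm] at this
      linarith
    simp only [Set.mem_iUnion, Set.mem_preimage, Finset.mem_Icc, exists_prop]
    refine ⟨round r, ?_, h1, h2, ?_, ?_⟩
    · rw [abs_le] at hk
      constructor
      · have : ((-(n:ℤ) - 1 : ℤ) : ℝ) ≤ (round r : ℝ) := by push_cast; linarith
        exact_mod_cast this
      · have : (round r : ℝ) ≤ ((n + 1 : ℤ) : ℝ) := by push_cast; linarith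
        exact_mod_cast this
    · show ‖x + (-(round r:ℝ)) • v‖ ≤ 5
      have e : ‖(-(round r:ℝ)) • v‖ ≤ (n + 1) * (2 / n) := by
        rw [norm_smul, norm_neg, Real.norm_eq_abs]; gcongr
      have e2 : ((n:ℝ) + 1) * (2 / n) ≤ 4 := by
        rw [mul_div_assoc', div_le_iff₀ hn0]; linarith
      linarith [norm_add_le x ((-(round r:ℝ)) • v)]
    · show |‖x + (-(round r:ℝ)) • v‖ ^ 2 - ‖ξ - (x + (-(round r:ℝ)) • v)‖ ^ 2| ≤ _
      rw [norm_sub_sq_real ξ, inner_add_right, real_inner_smul_right, hiv]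
      have : ‖x + (-(round r:ℝ)) • v‖ ^ 2 - (‖ξ‖ ^ 2 - 2 * (⟪ξ, x⟫ + -(round r:ℝ) * (1 / (n:ℝ) ^ 2))
          + ‖x + (-(round r:ℝ)) • v‖ ^ 2) = (r - round r) * (2 / n ^ 2) := by
        rw [hr]; field_simp; ring
      rw [this, abs_mul, abs_of_pos (by positivity : (0:ℝ) < 2 / n ^ 2)]
      calc _ ≤ 1 / 2 * (2 / (n:ℝ) ^ 2) := by gcongr
        _ = _ := by ring
  calc volume (Metric.ball (0 : Vd d) 1) ≤ _ := measure_mono hcov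
    _ ≤ ∑ k ∈ Finset.Icc (-(n:ℤ) - 1) (n + 1),
        volume ((fun y => y + (-(k:ℝ)) • v) ⁻¹' (Prod.mk ξ ⁻¹' lowFreqSet d n)) :=
      measure_biUnion_finset_le _ _
    _ = ∑ k ∈ Finset.Icc (-(n:ℤ) - 1) (n + 1), volume (Prod.mk ξ ⁻¹' lowFreqSet d n) := by
      simp only [measure_preimage_add_right]
    _ ≤ _ := by
      rw [Finset.sum_const, nsmul_eq_mul]
      gcongr
      rw [Int.card_Icc, ← ENNReal.ofReal_natCast]
      apply ENNReal.ofReal_le_ofReal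
      have : (((n:ℤ) + 1 + 1 - (-(n:ℤ) - 1)).toNat) = 2 * n + 3 := by omega
      rw [this]; push_cast; linarith

lemma volume_ball_toReal_pos (d : ℕ) : 0 < (volume (Metric.ball (0 : Vd d) 1)).toReal :=
  ENNReal.toReal_pos (Metric.measure_ball_pos _ _ one_pos).ne' measure_ball_lt_top.ne

lemma ofReal_le_volume_lowFreqSet {d n : ℕ} (hd : 1 ≤ d) (hn : 1 ≤ n) :
    ENNReal.ofReal ((volume (Metric.ball (0 : Vd d) 1)).toReal ^ 2 / (5 * 4 ^ d) /
      (n:ℝ) ^ (d + 1)) ≤ volume (lowFreqSet d n) := by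
  set v := (volume (Metric.ball (0 : Vd d) 1)).toReal with hv
  have hv0 : 0 < v := volume_ball_toReal_pos d
  have hve : volume (Metric.ball (0 : Vd d) 1) = ENNReal.ofReal v :=
    (ENNReal.ofReal_toReal measure_ball_lt_top.ne).symm
  have hn0 : (0:ℝ) < n := by exact_mod_cast hn
  let e : Vd d := EuclideanSpace.single ⟨0, hd⟩ (3 / (4 * (n:ℝ)))
  have he : ‖e‖ = 3 / (4 * (n:ℝ)) := by
    simp only [e, PiLp.norm_single]; exact Real.norm_of_nonneg (by positivity)
  have hB : volume (Metric.closedBall e (1 / (4 * (n:ℝ)))) =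
      ENNReal.ofReal ((1 / (4 * (n:ℝ))) ^ d * v) := by
    rw [Measure.addHaar_closedBall _ _ (by positivity), finrank_euclideanSpace_fin, hve,
      ENNReal.ofReal_mul (by positivity)]
  rw [Measure.volume_eq_prod, Measure.prod_apply (measurableSet_lowFreqSet d n)]
  calc _ = ∫⁻ ξ in Metric.closedBall e (1 / (4 * (n:ℝ))), ENNReal.ofReal (v / (5 * n)) := by
        rw [setLIntegral_const, hB, ← ENNReal.ofReal_mul (by positivity)]
        rw [div_pow, one_pow, mul_pow]
        congr 1
        field_simp
        ring
    _ ≤ ∫⁻ ξ in Metric.closedBall e (1 / (4 * (n:ℝ))), volume (Prod.mk ξ ⁻¹' lowFreqSet d n) := by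
        refine setLIntegral_mono' Metric.isClosed_closedBall.measurableSet fun ξ hξ => ?_
        rw [mem_closedBall_iff_norm] at hξ
        have a1 := abs_le.1 ((abs_norm_sub_norm_le ξ e).trans hξ)
        rw [he] at a1
        have h3 : 3 / (4 * (n:ℝ)) = 3 * (1 / (4 * n)) := by ring
        have h4 : 1 / (2 * (n:ℝ)) = 2 * (1 / (4 * n)) := by ring
        have h5 : 1 / (n:ℝ) = 4 * (1 / (4 * n)) := by ring
        have := volume_ball_le_section d hn (ξ := ξ) (by linarith [a1.1]) (by linarith [a1.2])
        rw [ENNReal.ofReal_div_of_pos (by positivity), ← hve]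
        exact ENNReal.div_le_of_le_mul' this
    _ ≤ _ := setLIntegral_le_lintegral _ _

lemma le_weight {s α₀ : ℝ} (h₀ : 0 ≤ α₀) {d n : ℕ} (hn : 1 ≤ n) {ξ : Vd d}
    (h1 : 1 / (2 * (n:ℝ)) ≤ ‖ξ‖) (h2 : ‖ξ‖ ≤ 1 / (n:ℝ)) :
    (1 / 2 : ℝ) ^ (2 * |s|) * (n:ℝ) ^ (-(2 * s)) ≤ ‖ξ‖ ^ (2 * s) * jb ξ ^ (2 * α₀) := by
  have hn0 : (0:ℝ) < n := by exact_mod_cast hn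
  rw [div_le_iff₀ (by positivity)] at h1
  rw [le_div_iff₀ (by positivity)] at h2
  have hξ : 0 < ‖ξ‖ := by
    by_contra h
    nlinarith
  have key : (1 / 2 : ℝ) ^ (2 * |s|) ≤ (‖ξ‖ * n) ^ (2 * s) :=
    calc _ ≤ (‖ξ‖ * n) ^ (2 * |s|) :=
          Real.rpow_le_rpow (by norm_num) (by linarith) (by positivity)
      _ ≤ _ := Real.rpow_le_rpow_of_exponent_ge (by positivity) h2 (by linarith [le_abs_self s])
  have hj : 1 ≤ jb ξ ^ (2 * α₀) := Real.one_le_rpow (one_le_jb ξ) (by linarith)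
  calc _ ≤ (‖ξ‖ * n) ^ (2 * s) * (n:ℝ) ^ (-(2 * s)) := by gcongr
    _ = ‖ξ‖ ^ (2 * s) * 1 := by
      rw [Real.mul_rpow hξ.le hn0.le, mul_assoc, ← Real.rpow_add hn0, add_neg_cancel,
        Real.rpow_zero]
    _ ≤ _ := by gcongr

lemma jb_weight_le {α₁ α₂ : ℝ} (h₁ : 0 ≤ α₁) (h₂ : 0 ≤ α₂) {d : ℕ} {η ζ : Vd d}
    (hη : ‖η‖ ≤ 6) (hζ : ‖ζ‖ ≤ 6) :
    jb η ^ (2 * α₁) * jb ζ ^ (2 * α₂) ≤ (7:ℝ) ^ (2 * α₁) * 7 ^ (2 * α₂) := by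
  have a := one_le_jb η
  have b := one_le_jb ζ
  have := jb_le hη
  have := jb_le hζ
  gcongr

lemma norm_sub_le_of_mem {d n : ℕ} (hn : 1 ≤ n) {q : Vd d × Vd d} (hq : q ∈ lowFreqSet d n) :
    ‖q.1 - q.2‖ ≤ 6 := by
  obtain ⟨-, h2, h3, -⟩ := hq
  have : 1 / (n:ℝ) ≤ 1 := by
    rw [div_le_one (by exact_mod_cast hn)]; exact_mod_cast hn
  linarith [norm_sub_le q.1 q.2]

lemma volume_section_lt_top (d n : ℕ) (ξ : Vd d) :
    volume (Prod.mk ξ ⁻¹' lowFreqSet d n) < ⊤ := by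
  refine lt_of_le_of_lt (measure_mono (t := Metric.closedBall 0 5) ?_)
    (isCompact_closedBall _ _).measure_lt_top
  rintro η ⟨-, -, h, -⟩
  exact mem_closedBall_zero_iff.2 h

/-- The indicator of `lowFreqSet`, written in the variables `(η, ξ - η)`. -/
def lowFreqKernel (d n : ℕ) (p : Vd d × Vd d) : ℂ :=
  (lowFreqSet d n).indicator 1 (p.1 + p.2, p.1)

lemma measurable_lowFreqKernel (d n : ℕ) : Measurable (lowFreqKernel d n) :=
  (measurable_one.indicator (measurableSet_lowFreqSet d n)).comp (by fun_prop)

/-- For `|t| ≤ n²/2` the phase does not oscillate on `lowFreqSet`. -/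
lemma le_enorm_densFT {d n : ℕ} (hn : 1 ≤ n) {t : ℝ} (ht : |t| ≤ (n:ℝ) ^ 2 / 2) (ξ : Vd d) :
    ENNReal.ofReal (((2 * Real.pi) ^ d)⁻¹ / 2) * volume (Prod.mk ξ ⁻¹' lowFreqSet d n) ≤
      (‖densFT (lowFreqKernel d n) t ξ‖₊ : ℝ≥0∞) := by
  have hn0 : (0:ℝ) < n := by exact_mod_cast hn
  set S := Prod.mk ξ ⁻¹' lowFreqSet d n with hS
  have hSm : MeasurableSet S := measurable_prodMk_left (measurableSet_lowFreqSet d n)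
  have hSf : volume S ≠ ⊤ := (volume_section_lt_top d n ξ).ne
  set e : Vd d → ℂ := fun η =>
    Complex.exp (-(Complex.I * Complex.ofReal (t * (‖η‖ ^ 2 - ‖ξ - η‖ ^ 2)))) with he
  have he' : ∀ η, e η = Complex.exp
      (Complex.ofReal (-(t * (‖η‖ ^ 2 - ‖ξ - η‖ ^ 2))) * Complex.I) := fun η => by
    simp only [he]
    congr 1
    push_cast
    ring
  have hre : ∀ η, (e η).re = Real.cos (t * (‖η‖ ^ 2 - ‖ξ - η‖ ^ 2)) := fun η => by
    rw [he', Complex.exp_ofReal_mul_I_re, Real.cos_neg]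
  have hint : IntegrableOn e S := by
    refine Measure.integrableOn_of_bounded (M := 1) hSf
      (by fun_prop : Continuous e).aestronglyMeasurable (ae_of_all _ fun η => ?_)
    rw [he', Complex.norm_exp_ofReal_mul_I]
  have hden : densFT (lowFreqKernel d n) t ξ =
      (((2 * Real.pi) ^ d)⁻¹ : ℝ) • ∫ η in S, e η := by
    rw [densFT, ← integral_indicator hSm]
    congr 1
    refine integral_congr_ae (ae_of_all _ fun η => ?_)
    simp only [lowFreqKernel, add_sub_cancel]
    by_cases h : (ξ, η) ∈ lowFreqSet d n
    · have h' : η ∈ S := h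
      simp [h, h', he]
    · have h' : η ∉ S := h
      simp [h, h']
  have hlow : (1 / 2) * (volume S).toReal ≤ ‖∫ η in S, e η‖ := by
    calc (1 / 2) * (volume S).toReal = ∫ η in S, (1 / 2 : ℝ) := by
          rw [setIntegral_const, smul_eq_mul, mul_comm]; rfl
      _ ≤ ∫ η in S, (e η).re := by
          refine setIntegral_mono_on (integrableOn_const hSf) hint.re hSm fun η hη => ?_
          rw [hre]
          have h1 : |t * (‖η‖ ^ 2 - ‖ξ - η‖ ^ 2)| ≤ 1 / 2 := by
            rw [abs_mul]
            calc _ ≤ (n:ℝ) ^ 2 / 2 * (1 / (n:ℝ) ^ 2) := by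
                  gcongr
                  exact hη.2.2.2
              _ = _ := by field_simp
          have h2 := Real.one_sub_sq_div_two_le_cos (x := t * (‖η‖ ^ 2 - ‖ξ - η‖ ^ 2))
          rw [← sq_abs] at h2
          nlinarith [abs_nonneg (t * (‖η‖ ^ 2 - ‖ξ - η‖ ^ 2))]
      _ = (∫ η in S, e η).re := integral_re hint
      _ ≤ _ := Complex.re_le_norm _
  rw [hden, ← ENNReal.ofReal_toReal hSf, ← ENNReal.ofReal_mul (by positivity),
    ← enorm_eq_nnnorm, ← ofReal_norm, norm_smul, Real.norm_of_nonneg (by positivity)]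
  apply ENNReal.ofReal_le_ofReal
  calc _ = ((2 * Real.pi) ^ d)⁻¹ * (1 / 2 * (volume S).toReal) := by ring
    _ ≤ _ := by gcongr

lemma lintegral_volume_section (d n : ℕ) :
    ∫⁻ ξ, volume (Prod.mk ξ ⁻¹' lowFreqSet d n) = volume (lowFreqSet d n) := by
  rw [Measure.volume_eq_prod, Measure.prod_apply (measurableSet_lowFreqSet d n)]

lemma le_densStriNorm_lowFreqKernel {s α₀ : ℝ} (h₀ : 0 ≤ α₀) {d n : ℕ} (hn : 1 ≤ n) :
    (ENNReal.ofReal ((1 / 2 : ℝ) ^ (2 * |s|) * (((2 * Real.pi) ^ d)⁻¹ / 2) ^ 2 *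
        ((volume (Metric.ball (0 : Vd d) 1)).toReal / 5) * (n:ℝ) ^ (1 - 2 * s)) *
      volume (lowFreqSet d n)) ^ ((1:ℝ) / 2) ≤ densStriNorm s α₀ (lowFreqKernel d n) := by
  set v := (volume (Metric.ball (0 : Vd d) 1)).toReal with hv
  have hv0 : 0 < v := volume_ball_toReal_pos d
  have hve : volume (Metric.ball (0 : Vd d) 1) = ENNReal.ofReal v :=
    (ENNReal.ofReal_toReal measure_ball_lt_top.ne).symm
  have hn0 : (0:ℝ) < n := by exact_mod_cast hn
  set w := (1 / 2 : ℝ) ^ (2 * |s|) * (n:ℝ) ^ (-(2 * s)) with hw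
  have hw0 : 0 < w := by positivity
  set κ := ((2 * Real.pi) ^ d)⁻¹ / 2 with hκ
  have hκ0 : 0 < κ := by positivity
  have hpt : ∀ t : ℝ, |t| ≤ (n:ℝ) ^ 2 / 2 → ∀ ξ : Vd d,
      ENNReal.ofReal (w * κ ^ 2 * (v / (5 * n))) * volume (Prod.mk ξ ⁻¹' lowFreqSet d n) ≤
      ENNReal.ofReal (‖ξ‖ ^ (2 * s) * jb ξ ^ (2 * α₀)) *
        (‖densFT (lowFreqKernel d n) t ξ‖₊ : ℝ≥0∞) ^ (2:ℝ) := by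
    intro t ht ξ
    by_cases hξ : 1 / (2 * (n:ℝ)) ≤ ‖ξ‖ ∧ ‖ξ‖ ≤ 1 / (n:ℝ)
    · have hm : ENNReal.ofReal (v / (5 * n)) ≤ volume (Prod.mk ξ ⁻¹' lowFreqSet d n) := by
        rw [ENNReal.ofReal_div_of_pos (by positivity), ← hve]
        exact ENNReal.div_le_of_le_mul' (volume_ball_le_section d hn hξ.1 hξ.2)
      calc _ = ENNReal.ofReal w * (ENNReal.ofReal κ ^ (2:ℝ) * (ENNReal.ofReal (v / (5 * n)) *
              volume (Prod.mk ξ ⁻¹' lowFreqSet d n))) := by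
            rw [ENNReal.ofReal_mul (by positivity), ENNReal.ofReal_mul (by positivity),
              ENNReal.ofReal_pow hκ0.le, ENNReal.rpow_two]
            ring
        _ ≤ ENNReal.ofReal w * (ENNReal.ofReal κ ^ (2:ℝ) *
              (volume (Prod.mk ξ ⁻¹' lowFreqSet d n)) ^ (2:ℝ)) := by
            rw [ENNReal.rpow_two (volume _), sq]; gcongr
        _ = ENNReal.ofReal w * (ENNReal.ofReal κ *
              volume (Prod.mk ξ ⁻¹' lowFreqSet d n)) ^ (2:ℝ) := by
            rw [ENNReal.mul_rpow_of_nonneg _ _ (by norm_num)]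
        _ ≤ _ := by
            gcongr
            · exact le_weight h₀ hn hξ.1 hξ.2
            · exact le_enorm_densFT hn ht ξ
    · have : Prod.mk ξ ⁻¹' lowFreqSet d n = ∅ :=
        Set.eq_empty_of_forall_notMem fun η hη => hξ ⟨hη.1, hη.2.1⟩
      simp [this]
  rw [densStriNorm]
  refine ENNReal.rpow_le_rpow ?_ (by norm_num)
  calc _ = ∫⁻ t in Set.Icc (-((n:ℝ) ^ 2 / 2)) ((n:ℝ) ^ 2 / 2),
        ENNReal.ofReal (w * κ ^ 2 * (v / (5 * n))) * volume (lowFreqSet d n) := by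
        rw [setLIntegral_const, Real.volume_Icc, mul_right_comm _ (volume _),
          ← ENNReal.ofReal_mul (by positivity)]
        congr 2
        rw [hw, sub_eq_add_neg 1, Real.rpow_add hn0, Real.rpow_one]
        field_simp
        ring
    _ ≤ ∫⁻ t in Set.Icc (-((n:ℝ) ^ 2 / 2)) ((n:ℝ) ^ 2 / 2), ∫⁻ ξ : Vd d,
          ENNReal.ofReal (‖ξ‖ ^ (2 * s) * jb ξ ^ (2 * α₀)) *
            (‖densFT (lowFreqKernel d n) t ξ‖₊ : ℝ≥0∞) ^ (2:ℝ) := by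
        refine setLIntegral_mono' measurableSet_Icc fun t ht => ?_
        rw [← lintegral_volume_section, ← lintegral_const_mul' _ _ ENNReal.ofReal_ne_top]
        exact lintegral_mono (hpt t (abs_le.2 ht))
    _ ≤ _ := setLIntegral_le_lintegral _ _

lemma wHSnorm_lowFreqKernel_le {α₁ α₂ : ℝ} (h₁ : 0 ≤ α₁) (h₂ : 0 ≤ α₂) {d n : ℕ} (hn : 1 ≤ n) :
    wHSnorm α₁ α₂ (lowFreqKernel d n) ≤
      (ENNReal.ofReal ((7:ℝ) ^ (2 * α₁) * 7 ^ (2 * α₂)) * volume (lowFreqSet d n)) ^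
        ((1:ℝ) / 2) := by
  have hpre : volume ((fun p : Vd d × Vd d => (p.1 + p.2, p.1)) ⁻¹' lowFreqSet d n) =
      volume (lowFreqSet d n) :=
    (Measure.measurePreserving_swap.comp (measurePreserving_prod_add volume volume)).measure_preimage
      (measurableSet_lowFreqSet d n).nullMeasurableSet
  have hm : MeasurableSet ((fun p : Vd d × Vd d => (p.1 + p.2, p.1)) ⁻¹' lowFreqSet d n) :=
    (by fun_prop : Measurable fun p : Vd d × Vd d => (p.1 + p.2, p.1))
      (measurableSet_lowFreqSet d n)
  rw [wHSnorm]
  refine ENNReal.rpow_le_rpow ?_ (by norm_num)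
  rw [← hpre, ← lintegral_indicator_const hm]
  refine lintegral_mono fun p => ?_
  by_cases hp : (p.1 + p.2, p.1) ∈ lowFreqSet d n
  · have hp' : p ∈ (fun p : Vd d × Vd d => (p.1 + p.2, p.1)) ⁻¹' lowFreqSet d n := hp
    have h5 : ‖p.1‖ ≤ 6 := hp.2.2.1.trans (by norm_num)
    have h6 := norm_sub_le_of_mem hn hp
    simp only [add_sub_cancel_left] at h6
    rw [Set.indicator_of_mem hp', lowFreqKernel, Set.indicator_of_mem hp]
    simpa using ENNReal.ofReal_le_ofReal (jb_weight_le h₁ h₂ h5 h6)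
  · simp [lowFreqKernel, hp]

lemma le_dualStriNorm_lowFreqTest {s α₀ α₁ α₂ : ℝ} (h₀ : 0 ≤ α₀) (h₁ : 0 ≤ α₁) (h₂ : 0 ≤ α₂)
    {d n : ℕ} (hd : 1 ≤ d) (hn : 1 ≤ n) :
    ENNReal.ofReal (((1 / 2 : ℝ) ^ (2 * |s|) / ((7:ℝ) ^ (2 * α₁) * 7 ^ (2 * α₂)) *
      ((volume (Metric.ball (0 : Vd d) 1)).toReal ^ 2 / (5 * 4 ^ d))) ^ ((1:ℝ) / 2)) *
      ENNReal.ofReal ((n:ℝ) ^ ((1 - 2 * s) / 2)) ≤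
    dualStriNorm s α₀ α₁ α₂ (lowFreqTest d n) := by
  set v := (volume (Metric.ball (0 : Vd d) 1)).toReal with hv
  have hv0 : 0 < v := volume_ball_toReal_pos d
  have hn0 : (0:ℝ) < n := by exact_mod_cast hn
  set w := (1 / 2 : ℝ) ^ (2 * |s|) with hw
  have hw0 : 0 < w := by positivity
  set K := (7:ℝ) ^ (2 * α₁) * 7 ^ (2 * α₂) with hK
  have hK0 : 0 < K := by positivity
  rw [dualStriNorm, div_eq_mul_one_div (1 - 2 * s), Real.rpow_mul hn0.le,
    ← ENNReal.ofReal_rpow_of_pos (by positivity), ← ENNReal.ofReal_rpow_of_pos (by positivity),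
    ← ENNReal.mul_rpow_of_nonneg _ _ (by norm_num)]
  refine ENNReal.rpow_le_rpow ?_ (by norm_num)
  calc _ = ENNReal.ofReal (w * (n:ℝ) ^ (-(2 * s)) / K * (n:ℝ) ^ (d + 2)) *
        ENNReal.ofReal (v ^ 2 / (5 * 4 ^ d) / (n:ℝ) ^ (d + 1)) := by
        rw [← ENNReal.ofReal_mul (by positivity), ← ENNReal.ofReal_mul (by positivity)]
        congr 1
        rw [sub_eq_add_neg 1, Real.rpow_add hn0, Real.rpow_one]
        field_simp
        ring
    _ ≤ ENNReal.ofReal (w * (n:ℝ) ^ (-(2 * s)) / K * (n:ℝ) ^ (d + 2)) *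
        volume (lowFreqSet d n) := by
        gcongr
        exact ofReal_le_volume_lowFreqSet hd hn
    _ = ∫⁻ q in lowFreqSet d n,
        ENNReal.ofReal (w * (n:ℝ) ^ (-(2 * s)) / K * (n:ℝ) ^ (d + 2)) :=
      (setLIntegral_const _ _).symm
    _ ≤ _ := (setLIntegral_mono' (measurableSet_lowFreqSet d n) fun q hq => ?_).trans
      (setLIntegral_le_lintegral _ _)
  obtain ⟨q1, q2, q3, q4⟩ := id hq
  have hc : |-‖q.2‖ ^ 2 + ‖q.1 - q.2‖ ^ 2| ≤ 1 / (n:ℝ) ^ 2 := by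
    rwa [neg_add_eq_sub, abs_sub_comm]
  have hW : (‖lowFreqTest d n (-‖q.2‖ ^ 2 + ‖q.1 - q.2‖ ^ 2, q.1)‖₊ : ℝ≥0∞) ^ (2:ℝ) =
      ENNReal.ofReal ((n:ℝ) ^ (d + 2)) := by
    rw [lowFreqTest, if_pos ⟨hc, q2⟩, mul_one, ← enorm_eq_nnnorm, ← ofReal_norm,
      Complex.norm_real, Real.norm_of_nonneg (by positivity),
      ENNReal.ofReal_rpow_of_pos (by positivity), ← Real.rpow_mul hn0.le,
      div_mul_cancel₀ _ two_ne_zero]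
    norm_cast
  rw [hW, ENNReal.ofReal_mul (by positivity)]
  have j1 := one_le_jb q.2
  have j2 := one_le_jb (q.1 - q.2)
  have hle := le_weight (s := s) h₀ hn q1 q2
  gcongr
  · exact le_trans (by positivity) hle
  exact jb_weight_le h₁ h₂ (q3.trans (by norm_num)) (norm_sub_le_of_mem hn hq)

lemma l2full_lowFreqTest (d : ℕ) {n : ℕ} (hn : 1 ≤ n) :
    l2full (lowFreqTest d n) =
      ENNReal.ofReal ((2 * (volume (Metric.ball (0 : Vd d) 1)).toReal) ^ ((1:ℝ) / 2)) := by
  set v := (volume (Metric.ball (0 : Vd d) 1)).toReal with hv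
  have hv0 : 0 < v := volume_ball_toReal_pos d
  have hve : volume (Metric.ball (0 : Vd d) 1) = ENNReal.ofReal v :=
    (ENNReal.ofReal_toReal measure_ball_lt_top.ne).symm
  have hn0 : (0:ℝ) < n := by exact_mod_cast hn
  set A : Set (ℝ × Vd d) := Set.Icc (-(1 / (n:ℝ) ^ 2)) (1 / (n:ℝ) ^ 2) ×ˢ
    Metric.closedBall 0 (1 / (n:ℝ)) with hA
  have hAm : MeasurableSet A := measurableSet_Icc.prod Metric.isClosed_closedBall.measurableSet
  have hfun : (fun z : ℝ × Vd d => (‖lowFreqTest d n z‖₊ : ℝ≥0∞) ^ (2:ℝ)) =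
      A.indicator fun _ => ENNReal.ofReal ((n:ℝ) ^ (d + 2)) := by
    funext z
    have hz : z ∈ A ↔ |z.1| ≤ 1 / (n:ℝ) ^ 2 ∧ ‖z.2‖ ≤ 1 / (n:ℝ) := by
      rw [hA, Set.mem_prod, mem_closedBall_zero_iff, abs_le, Set.mem_Icc]
    by_cases h : z ∈ A
    · rw [Set.indicator_of_mem h, lowFreqTest, if_pos (hz.1 h), mul_one, ← enorm_eq_nnnorm,
        ← ofReal_norm, Complex.norm_real, Real.norm_of_nonneg (by positivity),
        ENNReal.ofReal_rpow_of_pos (by positivity), ← Real.rpow_mul hn0.le,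
        div_mul_cancel₀ _ two_ne_zero]
      norm_cast
    · rw [Set.indicator_of_notMem h, lowFreqTest, if_neg (hz.not.1 h)]
      simp
  rw [l2full, hfun, lintegral_indicator_const hAm, hA, Measure.volume_eq_prod, Measure.prod_prod,
    Real.volume_Icc, Measure.addHaar_closedBall _ _ (by positivity), finrank_euclideanSpace_fin,
    hve, sub_neg_eq_add, ← ENNReal.ofReal_mul (by positivity),
    ← ENNReal.ofReal_mul (by positivity), ← ENNReal.ofReal_mul (by positivity), ENNReal.ofReal_rpow_of_pos (by positivity)]
  congr 2
  rw [div_pow, one_pow]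
  field_simp
  ring

/-- optimality: necessity of the homogeneous half derivative.  Let `d ≥ 2`,
`α₁ + α₂ > (d-1)/2` and `α̃ < 1/2`.  Then for every `α₀ ≥ 0` the Strichartz estimate
`‖ |∇|^{α̃} ρ_{e^{itΔ}γ₀e^{-itΔ}} ‖_{L²_t H^{α₀}_x} ≤ C ‖⟨∇⟩^{α₁} γ₀ ⟨∇⟩^{α₂}‖_{𝔖²}` fails.
In particular, the dual norm on the low-frequency test functions `Ṽ_n` diverges at the rate
`n^{(1-2α̃)/2}` while `‖Ṽ_n‖_{L²_{τ,ξ}} ≈ 1`. -/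
theorem optimality_half_derivative
    (d : ℕ) (hd : 2 ≤ d) (α₁ α₂ : ℝ) (h₁ : 0 ≤ α₁) (h₂ : 0 ≤ α₂)
    (hsum : ((d:ℝ) - 1) / 2 < α₁ + α₂) (s : ℝ) (hs : s < 1/2) (α₀ : ℝ) (h₀ : 0 ≤ α₀) :
    (¬ ∃ C : ℝ≥0, ∀ G : Vd d × Vd d → ℂ, AEStronglyMeasurable G volume →
        densStriNorm s α₀ G ≤ C * wHSnorm α₁ α₂ G) ∧
    Tendsto (fun n : ℕ => dualStriNorm s α₀ α₁ α₂ (lowFreqTest d n)) atTop (𝓝 ⊤) ∧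
    (∃ c : ℝ≥0, 0 < c ∧ ∀ᶠ n : ℕ in atTop,
      (c : ℝ≥0∞) * ENNReal.ofReal ((n:ℝ) ^ ((1 - 2 * s) / 2)) ≤
        dualStriNorm s α₀ α₁ α₂ (lowFreqTest d n)) ∧
    (∃ c C : ℝ≥0, 0 < c ∧ ∀ n : ℕ, 1 ≤ n →
      (c : ℝ≥0∞) ≤ l2full (lowFreqTest d n) ∧ l2full (lowFreqTest d n) ≤ C) := by
  have hd1 : 1 ≤ d := by omega
  have hv0 : 0 < (volume (Metric.ball (0 : Vd d) 1)).toReal := volume_ball_toReal_pos d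
  set v := (volume (Metric.ball (0 : Vd d) 1)).toReal with hv
  have hdual : ∃ c : ℝ≥0, 0 < c ∧ ∀ n : ℕ, 1 ≤ n →
      (c : ℝ≥0∞) * ENNReal.ofReal ((n:ℝ) ^ ((1 - 2 * s) / 2)) ≤
        dualStriNorm s α₀ α₁ α₂ (lowFreqTest d n) :=
    ⟨_, Real.toNNReal_pos.2 (by positivity), fun n hn =>
      le_dualStriNorm_lowFreqTest (s := s) h₀ h₁ h₂ hd1 hn⟩
  refine ⟨?_, ?_, ?_, ?_⟩
  · rintro ⟨C, hC⟩
    set a := (1 / 2 : ℝ) ^ (2 * |s|) * (((2 * Real.pi) ^ d)⁻¹ / 2) ^ 2 * (v / 5) with ha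
    have ha0 : 0 < a := by positivity
    set K := (7:ℝ) ^ (2 * α₁) * 7 ^ (2 * α₂) with hK
    have hK0 : 0 < K := by positivity
    have hbound : ∀ n : ℕ, 1 ≤ n → a * (n:ℝ) ^ (1 - 2 * s) ≤ C ^ 2 * K := by
      intro n hn
      have hn0 : (0:ℝ) < n := by exact_mod_cast hn
      have hJ0 : volume (lowFreqSet d n) ≠ 0 :=
        ((ENNReal.ofReal_pos.2 (by positivity)).trans_le (ofReal_le_volume_lowFreqSet hd1 hn)).ne'
      have hJt : volume (lowFreqSet d n) ≠ ⊤ := (volume_lowFreqSet_lt_top d n).ne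
      have h := (le_densStriNorm_lowFreqKernel (s := s) h₀ (d := d) hn).trans
        ((hC _ (measurable_lowFreqKernel d n).aestronglyMeasurable).trans
          (mul_le_mul_right (wHSnorm_lowFreqKernel_le h₁ h₂ hn) _))
      have h' := ENNReal.rpow_le_rpow h (zero_le_two (α := ℝ))
      rw [ENNReal.mul_rpow_of_nonneg _ _ zero_le_two, ← ENNReal.rpow_mul, ← ENNReal.rpow_mul,
        one_div_mul_cancel two_ne_zero, ENNReal.rpow_one, ENNReal.rpow_one, ← mul_assoc,
        ENNReal.mul_le_mul_iff_left hJ0 hJt, ENNReal.rpow_two, ← ENNReal.ofReal_coe_nnreal,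
        ← ENNReal.ofReal_pow C.coe_nonneg, ← ENNReal.ofReal_mul (by positivity)] at h'
      exact (ENNReal.ofReal_le_ofReal_iff (by positivity)).1 h'
    have ht : Tendsto (fun n : ℕ => a * (n:ℝ) ^ (1 - 2 * s)) atTop atTop :=
      ((tendsto_rpow_atTop (by linarith)).comp tendsto_natCast_atTop_atTop).const_mul_atTop ha0
    obtain ⟨n, h1, h2⟩ :=
      ((ht.eventually_gt_atTop (C ^ 2 * K)).and (eventually_ge_atTop 1)).exists
    exact (hbound n h2).not_gt h1
  · obtain ⟨c, hc, h⟩ := hdual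
    have ht : Tendsto (fun n : ℕ => (c : ℝ≥0∞) * ENNReal.ofReal ((n:ℝ) ^ ((1 - 2 * s) / 2)))
        atTop (𝓝 ⊤) := by
      have := ENNReal.Tendsto.const_mul (a := (c : ℝ≥0∞)) (ENNReal.tendsto_ofReal_atTop.comp
        ((tendsto_rpow_atTop (y := (1 - 2 * s) / 2) (by linarith)).comp
          tendsto_natCast_atTop_atTop)) (Or.inl ENNReal.top_ne_zero)
      rwa [ENNReal.mul_top (by exact_mod_cast hc.ne')] at this
    exact tendsto_nhds_top_mono ht ((eventually_ge_atTop 1).mono h)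
  · obtain ⟨c, hc, h⟩ := hdual
    exact ⟨c, hc, (eventually_ge_atTop 1).mono h⟩
  · exact ⟨_, _, Real.toNNReal_pos.2 (by positivity), fun n hn =>
      ⟨(l2full_lowFreqTest d hn).ge, (l2full_lowFreqTest d hn).le⟩⟩
end
end

section
/- (Optimality, necessity of the regularity condition on α₀.) Let d ≥ 2 and α₁, α₂ ≥ 0 with α₁ + α₂ > (d−1)/2, and take the homogeneous exponent α̃ = 1/2. If α₀ ≥ 0 violates the admissible range, i.e., if α₀ > α₁ + α₂ − (d−1)/2 when max{α₁,α₂} < (d−1)/2, or α₀ ≥ min{α₁,α₂} when max{α₁,α₂} = (d−1)/2, or α₀ > min{α₁,α₂} when max{α₁,α₂} > (d−1)/2, then the Strichartz estimate ‖ |∇|^{1/2} ρ_{e^{itΔ} γ₀ e^{−itΔ}} ‖_{L²_t(ℝ; H^{α₀}_x)} ≤ C ‖⟨∇⟩^{α₁} γ₀ ⟨∇⟩^{α₂}‖_{𝔖²} fails: no finite constant C makes it hold for all Hilbert–Schmidt operators γ₀ on L²(ℝ^d). -/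
open MeasureTheory Complex Filter
open scoped ENNReal NNReal RealInnerProductSpace Topology ComplexConjugate

noncomputable section

section Swap

variable {d : ℕ}

lemma densFT_swap (G : Vd d × Vd d → ℂ) (t : ℝ) (ξ : Vd d) :
    densFT (G ∘ Prod.swap) t ξ = densFT G (-t) ξ := by
  unfold densFT
  congr 1
  rw [← integral_sub_left_eq_self _ volume ξ]
  refine integral_congr_ae (ae_of_all _ fun η => ?_)
  simp only [Function.comp, Prod.swap_prod_mk, sub_sub_cancel]
  congr 5
  ring

lemma densStriNorm_swap (s α₀ : ℝ) (G : Vd d × Vd d → ℂ) :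
    densStriNorm s α₀ (G ∘ Prod.swap) = densStriNorm s α₀ G := by
  unfold densStriNorm
  simp only [densFT_swap]
  rw [lintegral_neg_eq_self (fun t : ℝ => ∫⁻ ξ : Vd d,
      ENNReal.ofReal (‖ξ‖ ^ (2 * s) * jb ξ ^ (2 * α₀)) * (‖densFT G t ξ‖₊ : ℝ≥0∞) ^ (2:ℝ))]

lemma wHSnorm_swap (α₁ α₂ : ℝ) (G : Vd d × Vd d → ℂ) :
    wHSnorm α₁ α₂ (G ∘ Prod.swap) = wHSnorm α₂ α₁ G := by
  unfold wHSnorm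
  congr 1
  have h : MeasurePreserving (Prod.swap : Vd d × Vd d → Vd d × Vd d) volume volume :=
    Measure.measurePreserving_swap
  rw [← h.lintegral_comp_emb MeasurableEquiv.prodComm.measurableEmbedding]
  refine lintegral_congr fun p => ?_
  simp only [Function.comp, Prod.fst_swap, Prod.snd_swap]
  rw [mul_comm (jb p.2 ^ _), Prod.swap_swap]

end Swap

section Bracket

variable {d : ℕ}

lemma jb_pos (ξ : Vd d) : 0 < jb ξ := by unfold jb; positivity

lemma continuous_jb : Continuous (jb : Vd d → ℝ) := by
  unfold jb
  exact Continuous.rpow_const (by fun_prop) fun ξ => Or.inl (by positivity)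

lemma jb_eq_sqrt (ξ : Vd d) : jb ξ = √(1 + ‖ξ‖ ^ 2) := (Real.sqrt_eq_rpow _).symm

lemma norm_le_jb (ξ : Vd d) : ‖ξ‖ ≤ jb ξ := by
  rw [jb_eq_sqrt]
  exact Real.le_sqrt_of_sq_le (by linarith)

lemma jb_le_one_add_norm (ξ : Vd d) : jb ξ ≤ 1 + ‖ξ‖ := by
  rw [jb_eq_sqrt]
  refine Real.sqrt_le_iff.2 ⟨by positivity, ?_⟩
  nlinarith [norm_nonneg ξ]

lemma continuous_jb_rpow (s : ℝ) : Continuous fun ξ : Vd d => jb ξ ^ s :=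
  continuous_jb.rpow_const fun ξ => Or.inl (jb_pos ξ).ne'

end Bracket

section Slab

variable {d : ℕ}

/-- The box `{η : |η_{i₀}| ≤ 1, |η_i| ≤ n for i ≠ i₀}`. -/
def slab (i₀ : Fin d) (n : ℝ) : Set (Vd d) :=
  {η | ∀ i, |η i| ≤ if i = i₀ then 1 else n}

variable (i₀ : Fin d)

lemma slab_eq_preimage (n : ℝ) :
    slab i₀ n = (MeasurableEquiv.toLp 2 (Fin d → ℝ)).symm ⁻¹'
      Set.Icc (fun i => -(if i = i₀ then 1 else n)) (fun i => if i = i₀ then 1 else n) := by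
  ext η
  simp only [slab, Set.mem_ofPred_eq, Set.mem_preimage, Set.mem_Icc, Pi.le_def, ← forall_and,
    abs_le]
  rfl

lemma measurableSet_slab (n : ℝ) : MeasurableSet (slab i₀ n) := by
  rw [slab_eq_preimage]
  exact (MeasurableEquiv.measurable _) measurableSet_Icc

lemma volume_slab {n : ℝ} (hn : 0 ≤ n) :
    volume (slab i₀ n) = ENNReal.ofReal (2 ^ d * n ^ (d - 1)) := by
  rw [slab_eq_preimage,
    (EuclideanSpace.volume_preserving_symm_measurableEquiv_toLp (Fin d)).measure_preimage
      measurableSet_Icc.nullMeasurableSet, Real.volume_Icc_pi,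
    ← ENNReal.ofReal_prod_of_nonneg (fun i _ => by split_ifs <;> linarith)]
  congr 1
  have : ∀ i : Fin d, (if i = i₀ then (1:ℝ) else n) - -(if i = i₀ then 1 else n)
      = 2 * (if i = i₀ then 1 else n) := fun i => by ring
  simp only [this, Finset.prod_mul_distrib, Finset.prod_const, Finset.card_univ, Fintype.card_fin]
  rw [Finset.prod_ite]
  simp [Finset.filter_ne', Finset.card_erase_of_mem]

lemma volume_slab_ne_top {n : ℝ} (hn : 0 ≤ n) : volume (slab i₀ n) ≠ ∞ := by
  rw [volume_slab i₀ hn]; exact ENNReal.ofReal_ne_top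

lemma slab_mono {m n : ℝ} (h : m ≤ n) : slab i₀ m ⊆ slab i₀ n := fun η hη i => by
  refine (hη i).trans ?_
  split_ifs <;> linarith

lemma norm_le_of_mem_slab {n : ℝ} (hn : 1 ≤ n) {η : Vd d} (hη : η ∈ slab i₀ n) :
    ‖η‖ ≤ d * n := by
  have hd : (1:ℝ) ≤ d := by exact_mod_cast i₀.pos
  refine le_of_abs_le (abs_le_of_sq_le_sq ?_ (by positivity))
  rw [EuclideanSpace.norm_sq_eq]
  calc ∑ i, ‖η i‖ ^ 2 ≤ ∑ _i : Fin d, n ^ 2 := by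
        refine Finset.sum_le_sum fun i _ => ?_
        refine pow_le_pow_left₀ (norm_nonneg _) ((hη i).trans ?_) 2
        split_ifs <;> linarith
    _ = d * n ^ 2 := by simp
    _ ≤ (d * n) ^ 2 := by
        nlinarith [sq_nonneg n,
          mul_le_mul_of_nonneg_right hd (by positivity : 0 ≤ (d:ℝ) * n ^ 2)]

lemma jb_le_of_mem_slab {n : ℝ} (hn : 1 ≤ n) {η : Vd d} (hη : η ∈ slab i₀ n) :
    jb η ≤ (d + 1) * n := by
  linarith [jb_le_one_add_norm η, norm_le_of_mem_slab i₀ hn hη]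

/-- The weighted mass `∫ ⟨η⟩^{-2α} dη` of `slab i₀ n`. -/
def slabMass (α n : ℝ) : ℝ := ∫ η in slab i₀ n, jb η ^ (-(2 * α))

lemma integrableOn_slab {α n : ℝ} (hα : 0 ≤ α) (hn : 0 ≤ n) :
    IntegrableOn (fun η : Vd d => jb η ^ (-(2 * α))) (slab i₀ n) := by
  refine IntegrableOn.of_bound (volume_slab_ne_top i₀ hn).lt_top
    (continuous_jb_rpow _).aestronglyMeasurable 1 (ae_of_all _ fun η => ?_)
  rw [Real.norm_of_nonneg (Real.rpow_nonneg (jb_pos η).le _)]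
  refine Real.rpow_le_one_of_one_le_of_nonpos ?_ (by linarith)
  rw [jb_eq_sqrt]
  exact Real.one_le_sqrt.2 (by nlinarith [sq_nonneg ‖η‖])

lemma slabMass_nonneg (α n : ℝ) : 0 ≤ slabMass i₀ α n :=
  integral_nonneg fun η => Real.rpow_nonneg (jb_pos η).le _

lemma slabMass_mono {α m n : ℝ} (hα : 0 ≤ α) (hm : 0 ≤ m) (h : m ≤ n) :
    slabMass i₀ α m ≤ slabMass i₀ α n :=
  setIntegral_mono_set (integrableOn_slab i₀ hα (hm.trans h))
    (ae_of_all _ fun η => Real.rpow_nonneg (jb_pos η).le _)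
    (slab_mono i₀ h).eventuallyLE

lemma rpow_le_jb_rpow_of_mem_slab {α n : ℝ} (hα : 0 ≤ α) (hn : 1 ≤ n) {η : Vd d}
    (hη : η ∈ slab i₀ n) : ((d + 1) * n) ^ (-(2 * α)) ≤ jb η ^ (-(2 * α)) :=
  Real.rpow_le_rpow_of_nonpos (jb_pos η) (jb_le_of_mem_slab i₀ hn hη) (by linarith)

lemma le_slabMass {α n : ℝ} (hα : 0 ≤ α) (hn : 1 ≤ n) :
    ((d + 1) * n) ^ (-(2 * α)) * (2 ^ d * n ^ (d - 1)) ≤ slabMass i₀ α n := by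
  have hn0 : 0 ≤ n := by linarith
  have h := setIntegral_mono_on (μ := volume) (s := slab i₀ n)
    (f := fun _ : Vd d => ((d + 1) * n) ^ (-(2 * α))) (g := fun η => jb η ^ (-(2 * α)))
    (integrableOn_const (volume_slab_ne_top i₀ hn0)) (integrableOn_slab i₀ hα hn0)
    (measurableSet_slab i₀ n) (fun η hη => rpow_le_jb_rpow_of_mem_slab i₀ hα hn hη)
  rw [setIntegral_const, Measure.real, volume_slab i₀ hn0,
    ENNReal.toReal_ofReal (by positivity), smul_eq_mul, mul_comm] at h
  exact h

lemma slabMass_pos {α n : ℝ} (hα : 0 ≤ α) (hn : 1 ≤ n) : 0 < slabMass i₀ α n :=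
  lt_of_lt_of_le (by positivity) (le_slabMass i₀ hα hn)

lemma slabMass_double (hd : 2 ≤ d) {α n : ℝ} (hα : 0 ≤ α) (hn : 1 ≤ n) :
    slabMass i₀ α n + ((d + 1) * (2 * n)) ^ (-(2 * α)) * (2 ^ d * n ^ (d - 1))
      ≤ slabMass i₀ α (2 * n) := by
  have hn0 : 0 ≤ n := by linarith
  have hsub : slab i₀ n ⊆ slab i₀ (2 * n) := slab_mono i₀ (by linarith)
  have hmeas := (measurableSet_slab i₀ (2 * n)).diff (measurableSet_slab i₀ n)
  have hint := integrableOn_slab i₀ hα (by linarith : 0 ≤ 2 * n)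
  have hsplit := setIntegral_sdiff (measurableSet_slab i₀ n) hint hsub
  have hvol : 2 ^ d * n ^ (d - 1) ≤ volume.real (slab i₀ (2 * n) \ slab i₀ n) := by
    rw [measureReal_sdiff hsub (measurableSet_slab i₀ n)
      (volume_slab_ne_top i₀ (by linarith : 0 ≤ 2 * n))]
    rw [Measure.real, Measure.real, volume_slab i₀ hn0, volume_slab i₀ (by linarith : 0 ≤ 2 * n),
      ENNReal.toReal_ofReal (by positivity), ENNReal.toReal_ofReal (by positivity), mul_pow]
    have h2 : (2:ℝ) ≤ 2 ^ (d - 1) := by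
      calc (2:ℝ) = 2 ^ 1 := by norm_num
        _ ≤ 2 ^ (d - 1) := pow_le_pow_right₀ (by norm_num) (by omega)
    have h3 : (0:ℝ) ≤ 2 ^ d * n ^ (d - 1) := by positivity
    nlinarith
  have hfin : volume (slab i₀ (2 * n) \ slab i₀ n) ≠ ∞ :=
    measure_ne_top_of_subset Set.sdiff_subset (volume_slab_ne_top i₀ (by linarith : 0 ≤ 2 * n))
  have h := setIntegral_mono_on (μ := volume) (s := slab i₀ (2 * n) \ slab i₀ n)
    (f := fun _ : Vd d => ((d + 1) * (2 * n)) ^ (-(2 * α))) (g := fun η => jb η ^ (-(2 * α)))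
    (integrableOn_const hfin) (hint.mono_set Set.sdiff_subset) hmeas
    (fun η hη => rpow_le_jb_rpow_of_mem_slab i₀ hα (by linarith) hη.1)
  rw [setIntegral_const, smul_eq_mul, hsplit] at h
  have h4 := mul_le_mul_of_nonneg_right hvol
    (by positivity : 0 ≤ ((d + 1) * (2 * n)) ^ (-(2 * α)))
  unfold slabMass
  linarith

end Slab

section TestKernel

variable {d : ℕ} (i₀ : Fin d)

/-- The ball of radius `1/2` around `n e_{i₀}`. -/
def freqBall (n : ℝ) : Set (Vd d) := Metric.closedBall (EuclideanSpace.single i₀ n) (1 / 2)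

lemma measurableSet_freqBall (n : ℝ) : MeasurableSet (freqBall i₀ n) :=
  Metric.isClosed_closedBall.measurableSet

/-- The test function `⟨η⟩^{-2α} 𝟙_{slab}(η) 𝟙_{freqBall}(η + ζ)`. -/
def testKernel (α n : ℝ) (p : Vd d × Vd d) : ℂ :=
  (((slab i₀ n).indicator (fun η => jb η ^ (-(2 * α))) p.1 *
    (freqBall i₀ n).indicator 1 (p.1 + p.2) : ℝ) : ℂ)

lemma measurable_testKernel (α n : ℝ) : Measurable (testKernel i₀ α n) := by
  unfold testKernel
  refine Complex.measurable_ofReal.comp (Measurable.mul ?_ ?_)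
  · exact ((continuous_jb_rpow _).measurable.indicator (measurableSet_slab i₀ n)).comp
      measurable_fst
  · exact (measurable_one.indicator (measurableSet_freqBall i₀ n)).comp
      (measurable_fst.add measurable_snd)

lemma norm_sub_single_le {n : ℝ} {ξ : Vd d} (hξ : ξ ∈ freqBall i₀ n) :
    ‖ξ - EuclideanSpace.single i₀ n‖ ≤ 1 / 2 := by
  rw [← dist_eq_norm]; exact hξ

lemma norm_le_of_mem_freqBall {n : ℝ} (hn : 1 ≤ n) {ξ : Vd d} (hξ : ξ ∈ freqBall i₀ n) :
    ‖ξ‖ ≤ n + 1 / 2 := by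
  have h := norm_le_norm_add_norm_sub' ξ (EuclideanSpace.single i₀ n)
  rw [PiLp.norm_single, Real.norm_of_nonneg (by linarith)] at h
  linarith [norm_sub_single_le i₀ hξ]

lemma half_le_norm_of_mem_freqBall {n : ℝ} (hn : 1 ≤ n) {ξ : Vd d} (hξ : ξ ∈ freqBall i₀ n) :
    n / 2 ≤ ‖ξ‖ := by
  have h := norm_le_norm_add_norm_sub ξ (EuclideanSpace.single i₀ n)
  rw [PiLp.norm_single, Real.norm_of_nonneg (by linarith)] at h
  linarith [norm_sub_single_le i₀ hξ]

lemma abs_inner_le_of_mem {n : ℝ} (hn : 1 ≤ n) {ξ η : Vd d} (hξ : ξ ∈ freqBall i₀ n)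
    (hη : η ∈ slab i₀ n) : |⟪ξ, η⟫| ≤ (d + 1) * n := by
  have h1 : ⟪ξ, η⟫ = n * η i₀ + ⟪ξ - EuclideanSpace.single i₀ n, η⟫ := by
    rw [inner_sub_left, EuclideanSpace.inner_single_left]
    simp
  have h2 : |n * η i₀| ≤ n := by
    rw [abs_mul, abs_of_nonneg (by linarith : 0 ≤ n)]
    have := hη i₀
    rw [if_pos rfl] at this
    nlinarith
  have h3 : |⟪ξ - EuclideanSpace.single i₀ n, η⟫| ≤ d * n :=
    (abs_real_inner_le_norm _ _).trans <| by
      nlinarith [norm_sub_single_le i₀ hξ, norm_le_of_mem_slab i₀ hn hη, norm_nonneg η]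
  rw [h1]
  linarith [abs_add_le (n * η i₀) ⟪ξ - EuclideanSpace.single i₀ n, η⟫]

lemma densFT_testKernel_ge {α n t : ℝ} (hα : 0 ≤ α) (hn : 1 ≤ n) (ht : 0 ≤ t)
    (htn : 2 * t * ((d + 1) * n) ≤ 1) {ξ : Vd d} (hξ : ξ ∈ freqBall i₀ n) :
    ((2 * Real.pi) ^ d)⁻¹ * (slabMass i₀ α n / 2) ≤ ‖densFT (testKernel i₀ α n) t ξ‖ := by
  unfold densFT
  rw [norm_smul, Real.norm_of_nonneg (by positivity)]
  refine mul_le_mul_of_nonneg_left ?_ (by positivity)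
  set F : Vd d → ℂ := fun η =>
    Complex.exp (-(Complex.I * Complex.ofReal (t * (2 * ⟪ξ, η⟫)))) *
      ((jb η ^ (-(2 * α)) : ℝ) : ℂ) with hF
  have hint := integrableOn_slab i₀ hα (by linarith : 0 ≤ n)
  have hre : ∀ η, (F η).re = Real.cos (t * (2 * ⟪ξ, η⟫)) * jb η ^ (-(2 * α)) := fun η => by
    rw [hF, Complex.re_mul_ofReal, Complex.exp_re]
    simp
  have hnormF : ∀ η, ‖F η‖ = jb η ^ (-(2 * α)) := fun η => by
    have h := Complex.norm_exp_ofReal_mul_I (-(t * (2 * ⟪ξ, η⟫)))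
    rw [show ((-(t * (2 * ⟪ξ, η⟫)) : ℝ) : ℂ) * Complex.I
      = -(Complex.I * Complex.ofReal (t * (2 * ⟪ξ, η⟫))) by push_cast; ring] at h
    rw [hF, norm_mul, h, one_mul, Complex.norm_real,
      Real.norm_of_nonneg (Real.rpow_nonneg (jb_pos η).le _)]
  have hcont : Continuous F := by
    have := continuous_jb_rpow (d := d) (-(2 * α))
    fun_prop
  have hFint : IntegrableOn F (slab i₀ n) :=
    hint.mono' hcont.aestronglyMeasurable (ae_of_all _ fun η => (hnormF η).le)
  have hrew : ∫ η : Vd d, Complex.exp (-(Complex.I *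
        Complex.ofReal (t * (‖η‖ ^ 2 - ‖ξ - η‖ ^ 2)))) * testKernel i₀ α n (η, ξ - η)
      = Complex.exp (((t * ‖ξ‖ ^ 2 : ℝ) : ℂ) * Complex.I) * ∫ η in slab i₀ n, F η := by
    rw [← integral_const_mul, ← integral_indicator (measurableSet_slab i₀ n)]
    refine integral_congr_ae (ae_of_all _ fun η => ?_)
    by_cases hη : η ∈ slab i₀ n
    · simp only [testKernel, Set.indicator_of_mem hη, add_sub_cancel, Set.indicator_of_mem hξ,
        Pi.one_apply, mul_one, hF]
      rw [← mul_assoc, ← Complex.exp_add]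
      congr 2
      rw [norm_sub_sq_real]
      push_cast
      ring
    · simp [testKernel, Set.indicator_of_notMem hη]
  rw [hrew, norm_mul, Complex.norm_exp_ofReal_mul_I, one_mul]
  refine le_trans ?_ (Complex.re_le_norm _)
  have hreint : (∫ η in slab i₀ n, F η).re = ∫ η in slab i₀ n, (F η).re :=
    (integral_re hFint).symm
  rw [hreint, slabMass, ← integral_div]
  refine setIntegral_mono_on (hint.div_const 2) hFint.re (measurableSet_slab i₀ n)
    fun η hη => ?_
  rw [hre, div_eq_inv_mul]
  refine mul_le_mul_of_nonneg_right ?_ (Real.rpow_nonneg (jb_pos η).le _)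
  have hb : |t * (2 * ⟪ξ, η⟫)| ≤ 1 := by
    rw [abs_mul, abs_mul, abs_of_nonneg ht, abs_two]
    nlinarith [abs_inner_le_of_mem i₀ hn hξ hη]
  have hsq : (t * (2 * ⟪ξ, η⟫)) ^ 2 ≤ 1 := (sq_le_one_iff_abs_le_one _).2 hb
  linarith [Real.one_sub_sq_div_two_le_cos (x := t * (2 * ⟪ξ, η⟫))]

lemma densStriNorm_testKernel_ge {α α₀ n : ℝ} (hα : 0 ≤ α) (h₀ : 0 ≤ α₀) (hn : 1 ≤ n) :
    (ENNReal.ofReal (1 / (2 * ((d + 1) * n)) * ((n / 2) * (n / 2) ^ (2 * α₀) *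
      (((2 * Real.pi) ^ d)⁻¹ * (slabMass i₀ α n / 2)) ^ 2)) * volume (freqBall i₀ n))
        ^ ((1:ℝ) / 2) ≤ densStriNorm ((1:ℝ) / 2) α₀ (testKernel i₀ α n) := by
  unfold densStriNorm
  refine ENNReal.rpow_le_rpow ?_ (by norm_num)
  set T : ℝ := 1 / (2 * ((d + 1) * n)) with hT
  set m : ℝ := ((2 * Real.pi) ^ d)⁻¹ * (slabMass i₀ α n / 2) with hm
  have hm0 : 0 ≤ m := mul_nonneg (by positivity) (div_nonneg (slabMass_nonneg i₀ α n) (by norm_num))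
  have hT0 : 0 ≤ T := by positivity
  have hinner : ∀ t ∈ Set.Icc 0 T,
      ENNReal.ofReal ((n / 2) * (n / 2) ^ (2 * α₀) * m ^ 2) * volume (freqBall i₀ n) ≤
      ∫⁻ ξ : Vd d, ENNReal.ofReal (‖ξ‖ ^ (2 * ((1:ℝ) / 2)) * jb ξ ^ (2 * α₀)) *
        (‖densFT (testKernel i₀ α n) t ξ‖₊ : ℝ≥0∞) ^ (2:ℝ) := fun t ht => by
    rw [← setLIntegral_const]
    refine le_trans (setLIntegral_mono' (measurableSet_freqBall i₀ n)
      fun ξ hξ => ?_) (setLIntegral_le_lintegral (freqBall i₀ n) _)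
    have htn : 2 * t * ((d + 1) * n) ≤ 1 := by
      have := ht.2
      rw [hT, le_div_iff₀ (by positivity)] at this
      linarith
    have hge := densFT_testKernel_ge i₀ hα hn ht.1 htn hξ
    have hnorm := half_le_norm_of_mem_freqBall i₀ hn hξ
    rw [ENNReal.ofReal_mul (by positivity)]
    refine mul_le_mul' (ENNReal.ofReal_le_ofReal ?_) ?_
    · rw [show 2 * ((1:ℝ) / 2) = 1 by norm_num, Real.rpow_one]
      exact mul_le_mul hnorm (Real.rpow_le_rpow (by positivity) (hnorm.trans (norm_le_jb ξ))
        (by linarith)) (by positivity) (norm_nonneg _)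
    · rw [ENNReal.ofReal_pow hm0, ENNReal.rpow_two]
      refine pow_le_pow_left₀ zero_le ?_ 2
      rw [← enorm_eq_nnnorm, ← ofReal_norm]
      exact ENNReal.ofReal_le_ofReal hge
  calc _ = ∫⁻ _t in Set.Icc 0 T,
        ENNReal.ofReal ((n / 2) * (n / 2) ^ (2 * α₀) * m ^ 2) * volume (freqBall i₀ n) := by
        rw [setLIntegral_const, Real.volume_Icc, sub_zero, ENNReal.ofReal_mul hT0]
        ring
    _ ≤ _ := le_trans (setLIntegral_mono' measurableSet_Icc hinner) (setLIntegral_le_lintegral _ _)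

lemma wHSnorm_testKernel_le {α₁ α₂ n : ℝ} (h₁ : 0 ≤ α₁) (h₂ : 0 ≤ α₂) (hn : 1 ≤ n) :
    wHSnorm α₁ α₂ (testKernel i₀ α₁ n) ≤
      (ENNReal.ofReal (((d + 3) * n) ^ (2 * α₂) * slabMass i₀ α₁ n) * volume (freqBall i₀ n))
        ^ ((1:ℝ) / 2) := by
  unfold wHSnorm
  refine ENNReal.rpow_le_rpow ?_ (by norm_num)
  set f : Vd d → ℝ≥0∞ := (slab i₀ n).indicator
    fun η => ENNReal.ofReal (((d + 3) * n) ^ (2 * α₂) * jb η ^ (-(2 * α₁))) with hf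
  set g : Vd d → ℝ≥0∞ := (freqBall i₀ n).indicator 1 with hg
  have hfm : Measurable f := Measurable.indicator
    ((continuous_jb_rpow _).measurable.const_mul _).ennreal_ofReal (measurableSet_slab i₀ n)
  have hgm : Measurable g :=
    measurable_one.indicator (measurableSet_freqBall i₀ n)
  have hpt : ∀ p : Vd d × Vd d, ENNReal.ofReal (jb p.1 ^ (2 * α₁) * jb p.2 ^ (2 * α₂)) *
      (‖testKernel i₀ α₁ n p‖₊ : ℝ≥0∞) ^ (2:ℝ) ≤ f p.1 * g (p.1 + p.2) := fun p => by
    by_cases hη : p.1 ∈ slab i₀ n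
    · by_cases hξ : p.1 + p.2 ∈ freqBall i₀ n
      · have hpos := jb_pos p.1
        have hζ : jb p.2 ≤ (d + 3) * n := by
          have h1 := norm_le_of_mem_freqBall i₀ hn hξ
          have h2 := norm_le_of_mem_slab i₀ hn hη
          have h3 : ‖p.2‖ ≤ ‖p.1 + p.2‖ + ‖p.1‖ := by
            simpa using norm_sub_le (p.1 + p.2) p.1
          linarith [jb_le_one_add_norm p.2]
        simp only [testKernel, hf, hg, Set.indicator_of_mem hη, Set.indicator_of_mem hξ,
          Pi.one_apply, mul_one]
        rw [← enorm_eq_nnnorm, ← ofReal_norm, Complex.norm_real, ENNReal.rpow_two,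
          Real.norm_of_nonneg (by positivity), ← ENNReal.ofReal_pow (by positivity),
          ← ENNReal.ofReal_mul (mul_nonneg (by positivity) (Real.rpow_nonneg (jb_pos _).le _))]
        refine ENNReal.ofReal_le_ofReal ?_
        have hcancel : jb p.1 ^ (2 * α₁) * jb p.1 ^ (-(2 * α₁)) = 1 := by
          rw [← Real.rpow_add hpos]; simp
        calc _ = jb p.2 ^ (2 * α₂) * jb p.1 ^ (-(2 * α₁)) *
              (jb p.1 ^ (2 * α₁) * jb p.1 ^ (-(2 * α₁))) := by ring
          _ = jb p.2 ^ (2 * α₂) * jb p.1 ^ (-(2 * α₁)) := by rw [hcancel, mul_one]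
          _ ≤ _ := mul_le_mul_of_nonneg_right
            (Real.rpow_le_rpow (jb_pos _).le hζ (by linarith)) (by positivity)
      · simp [testKernel, Set.indicator_of_notMem hξ]
    · simp [testKernel, Set.indicator_of_notMem hη]
  refine (lintegral_mono hpt).trans_eq ?_
  rw [Measure.volume_eq_prod, lintegral_prod _ (by fun_prop)]
  have hin : ∀ η : Vd d, ∫⁻ ζ : Vd d, f η * g (η + ζ) = f η * volume (freqBall i₀ n) := fun η => by
    rw [lintegral_const_mul _ (by fun_prop), lintegral_add_left_eq_self g η, hg,
      lintegral_indicator_one (measurableSet_freqBall i₀ n)]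
  simp only [hin]
  rw [lintegral_mul_const _ hfm, hf, lintegral_indicator (measurableSet_slab i₀ n),
    ← ofReal_integral_eq_lintegral_ofReal
      ((integrableOn_slab i₀ h₁ (by linarith : 0 ≤ n)).const_mul _)
      (ae_of_all _ fun η => mul_nonneg (by positivity) (Real.rpow_nonneg (jb_pos η).le _)),
    integral_const_mul]
  rfl

end TestKernel

section Divergence

variable {d : ℕ} (i₀ : Fin d)

lemma exists_slabMass_le {α₀ α₁ α₂ : ℝ} (h₀ : 0 ≤ α₀) (h₁ : 0 ≤ α₁) (h₂ : 0 ≤ α₂)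
    (h : ∃ C : ℝ≥0, ∀ G : Vd d × Vd d → ℂ, AEStronglyMeasurable G volume →
      densStriNorm ((1:ℝ)/2) α₀ G ≤ C * wHSnorm α₁ α₂ G) :
    ∃ K : ℝ, ∀ n : ℝ, 1 ≤ n → n ^ (2 * α₀ - 2 * α₂) * slabMass i₀ α₁ n ≤ K := by
  obtain ⟨C, hC⟩ := h
  set c : ℝ := 1 / (2 * (d + 1)) * (1 / 2) * (1 / 2) ^ (2 * α₀) *
    (((2 * Real.pi) ^ d)⁻¹ / 2) ^ 2 with hc
  have hc0 : 0 < c := by positivity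
  refine ⟨(C:ℝ) ^ 2 * (d + 3) ^ (2 * α₂) / c, fun n hn => ?_⟩
  have hn0 : 0 < n := by linarith
  have hm := slabMass_pos i₀ h₁ hn
  set m := slabMass i₀ α₁ n with hmdef
  have hV0 : volume (freqBall i₀ n) ≠ 0 :=
    (Metric.measure_closedBall_pos volume _ (by norm_num)).ne'
  have hVt : volume (freqBall i₀ n) ≠ ∞ := measure_closedBall_lt_top.ne
  have key := (densStriNorm_testKernel_ge i₀ h₁ h₀ hn).trans
    ((hC _ (measurable_testKernel i₀ α₁ n).aestronglyMeasurable).trans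
      (mul_le_mul_right (wHSnorm_testKernel_le i₀ h₁ h₂ hn) _))
  have key2 := ENNReal.rpow_le_rpow key (by norm_num : (0:ℝ) ≤ 2)
  rw [ENNReal.mul_rpow_of_nonneg _ _ (by norm_num : (0:ℝ) ≤ 2), ← ENNReal.rpow_mul,
    ← ENNReal.rpow_mul, show (1:ℝ) / 2 * 2 = 1 by norm_num, ENNReal.rpow_one, ENNReal.rpow_one,
    ENNReal.rpow_two, ← mul_assoc (_ ^ 2 : ℝ≥0∞), ENNReal.mul_le_mul_iff_left hV0 hVt,
    ← ENNReal.ofReal_coe_nnreal, ← ENNReal.ofReal_pow (by positivity),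
    ← ENNReal.ofReal_mul (by positivity), ENNReal.ofReal_le_ofReal_iff (by positivity), ← hmdef,
    div_eq_mul_one_div n 2, Real.mul_rpow hn0.le (by norm_num),
    Real.mul_rpow (by positivity) hn0.le] at key2
  have key3 : c * n ^ (2 * α₀) * m * m ≤ C ^ 2 * (d + 3) ^ (2 * α₂) * n ^ (2 * α₂) * m := by
    refine le_trans (le_of_eq ?_) (key2.trans (le_of_eq (by ring)))
    rw [hc]
    field_simp
  have key4 := le_of_mul_le_mul_right key3 hm
  rw [le_div_iff₀ hc0, Real.rpow_sub hn0, div_mul_eq_mul_div, div_mul_eq_mul_div,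
    div_le_iff₀ (by positivity)]
  linarith

lemma exists_lt_mul_rpow {s c K : ℝ} (hs : 0 < s) (hc : 0 < c) :
    ∃ n : ℝ, 1 ≤ n ∧ K < c * n ^ s := by
  have h := (tendsto_rpow_atTop hs).const_mul_atTop hc
  exact ((eventually_ge_atTop 1).and (h.eventually_gt_atTop K)).exists

lemma slabMass_two_pow_ge (hd : 2 ≤ d) {α : ℝ} (hα : 0 ≤ α) (hcrit : α = ((d:ℝ) - 1) / 2)
    (k : ℕ) : k * ((2 * ((d:ℝ) + 1)) ^ (-(2 * α)) * 2 ^ d) ≤ slabMass i₀ α (2 ^ k) := by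
  induction k with
  | zero => simpa using slabMass_nonneg i₀ α _
  | succ k ih =>
    have hn : (1:ℝ) ≤ 2 ^ k := one_le_pow₀ (by norm_num)
    have hn0 : (0:ℝ) < 2 ^ k := by positivity
    have h := slabMass_double i₀ hd hα hn
    have hexp : ((2:ℝ) ^ k) ^ (-(2 * α)) * (2 ^ k) ^ (d - 1) = 1 := by
      rw [← Real.rpow_natCast _ (d - 1), ← Real.rpow_add hn0, Nat.cast_sub (by omega), hcrit]
      rw [show -(2 * (((d:ℝ) - 1) / 2)) + ((d:ℝ) - (1:ℕ)) = 0 by push_cast; ring, Real.rpow_zero]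
    have hterm : ((d + 1) * (2 * (2:ℝ) ^ k)) ^ (-(2 * α)) * (2 ^ d * (2 ^ k) ^ (d - 1))
        = (2 * ((d:ℝ) + 1)) ^ (-(2 * α)) * 2 ^ d := by
      rw [show ((d:ℝ) + 1) * (2 * (2:ℝ) ^ k) = (2 * ((d:ℝ) + 1)) * 2 ^ k by ring,
        Real.mul_rpow (by positivity) hn0.le]
      linear_combination ((2 * ((d:ℝ) + 1)) ^ (-(2 * α)) * 2 ^ d) * hexp
    rw [hterm] at h
    rw [pow_succ', Nat.cast_succ]
    linarith

lemma estimate_fails_of_le (hd : 2 ≤ d) {α₀ α₁ α₂ : ℝ} (h₀ : 0 ≤ α₀) (h₁ : 0 ≤ α₁)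
    (h₂ : 0 ≤ α₂)
    (hviol : (α₁ + α₂ - ((d:ℝ) - 1) / 2 < α₀) ∨ (α₁ = ((d:ℝ) - 1) / 2 ∧ α₂ ≤ α₀) ∨ α₂ < α₀) :
    ¬ ∃ C : ℝ≥0, ∀ G : Vd d × Vd d → ℂ, AEStronglyMeasurable G volume →
      densStriNorm ((1:ℝ)/2) α₀ G ≤ C * wHSnorm α₁ α₂ G := by
  intro h
  let i₀ : Fin d := ⟨0, by omega⟩
  obtain ⟨K, hK⟩ := exists_slabMass_le i₀ h₀ h₁ h₂ h
  rcases hviol with hv | ⟨hcrit, hv⟩ | hv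
  · obtain ⟨n, hn, hlt⟩ := exists_lt_mul_rpow (s := 2 * α₀ - 2 * α₂ - 2 * α₁ + (d - 1))
      (c := ((d:ℝ) + 1) ^ (-(2 * α₁)) * 2 ^ d) (K := K) (by linarith) (by positivity)
    have hn0 : 0 < n := by linarith
    have h5 := mul_le_mul_of_nonneg_left (le_slabMass i₀ h₁ hn)
      (by positivity : 0 ≤ n ^ (2 * α₀ - 2 * α₂))
    have h6 : n ^ (2 * α₀ - 2 * α₂ - 2 * α₁ + (d - 1))
        = n ^ (2 * α₀ - 2 * α₂) * n ^ (-(2 * α₁)) * n ^ (d - 1) := by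
      rw [← Real.rpow_natCast _ (d - 1), ← Real.rpow_add hn0, ← Real.rpow_add hn0,
        Nat.cast_sub (by omega)]
      congr 1
      push_cast
      ring
    rw [Real.mul_rpow (by positivity) hn0.le] at h5
    rw [h6] at hlt
    linarith [hK n hn]
  · set c := (2 * ((d:ℝ) + 1)) ^ (-(2 * α₁)) * 2 ^ d with hc
    have hc0 : 0 < c := by positivity
    obtain ⟨k, hk⟩ := exists_nat_gt (K / c)
    rw [div_lt_iff₀ hc0] at hk
    have hn : (1:ℝ) ≤ 2 ^ k := one_le_pow₀ (by norm_num)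
    have h5 := slabMass_two_pow_ge i₀ hd h₁ hcrit k
    have h6 := le_mul_of_one_le_left (slabMass_nonneg i₀ α₁ (2 ^ k))
      (Real.one_le_rpow hn (by linarith : 0 ≤ 2 * α₀ - 2 * α₂))
    linarith [hK _ hn]
  · obtain ⟨n, hn, hlt⟩ := exists_lt_mul_rpow (s := 2 * α₀ - 2 * α₂)
      (c := slabMass i₀ α₁ 1) (K := K) (by linarith) (slabMass_pos i₀ h₁ le_rfl)
    have h5 := mul_le_mul_of_nonneg_right (slabMass_mono i₀ h₁ zero_le_one hn)
      (by positivity : 0 ≤ n ^ (2 * α₀ - 2 * α₂))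
    linarith [hK n hn]

lemma estimate_swap {α₀ α₁ α₂ : ℝ}
    (h : ∃ C : ℝ≥0, ∀ G : Vd d × Vd d → ℂ, AEStronglyMeasurable G volume →
      densStriNorm ((1:ℝ)/2) α₀ G ≤ C * wHSnorm α₁ α₂ G) :
    ∃ C : ℝ≥0, ∀ G : Vd d × Vd d → ℂ, AEStronglyMeasurable G volume →
      densStriNorm ((1:ℝ)/2) α₀ G ≤ C * wHSnorm α₂ α₁ G := by
  obtain ⟨C, hC⟩ := h
  refine ⟨C, fun G hG => ?_⟩
  have := hC (G ∘ Prod.swap) (hG.comp_measurePreserving Measure.measurePreserving_swap)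
  rwa [densStriNorm_swap, wHSnorm_swap] at this

end Divergence

/-- optimality: necessity of the regularity condition on `α₀`.  Let `d ≥ 2`,
`α₁, α₂ ≥ 0` with `α₁ + α₂ > (d-1)/2`, and take `α̃ = 1/2`.  If `α₀ ≥ 0` violates the
admissible range (in the sense of the three cases below), then the Strichartz estimate
`‖ |∇|^{1/2} ρ_{e^{itΔ}γ₀e^{-itΔ}} ‖_{L²_t H^{α₀}_x} ≤ C ‖⟨∇⟩^{α₁} γ₀ ⟨∇⟩^{α₂}‖_{𝔖²}`
fails: no finite constant works for all Hilbert–Schmidt `γ₀` (described through `G = γ̂₀`). -/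
theorem optimality_regularity_condition
    (d : ℕ) (hd : 2 ≤ d) (α₁ α₂ : ℝ) (h₁ : 0 ≤ α₁) (h₂ : 0 ≤ α₂)
    (hsum : ((d:ℝ) - 1) / 2 < α₁ + α₂) (α₀ : ℝ) (h₀ : 0 ≤ α₀)
    (hviol :
      (max α₁ α₂ < ((d:ℝ) - 1) / 2 ∧ α₁ + α₂ - ((d:ℝ) - 1) / 2 < α₀) ∨
      (max α₁ α₂ = ((d:ℝ) - 1) / 2 ∧ min α₁ α₂ ≤ α₀) ∨
      (((d:ℝ) - 1) / 2 < max α₁ α₂ ∧ min α₁ α₂ < α₀)) :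
    ¬ ∃ C : ℝ≥0, ∀ G : Vd d × Vd d → ℂ, AEStronglyMeasurable G volume →
        densStriNorm ((1:ℝ)/2) α₀ G ≤ C * wHSnorm α₁ α₂ G := by
  rcases le_total α₂ α₁ with h | h
  · rw [max_eq_left h, min_eq_right h] at hviol
    exact estimate_fails_of_le hd h₀ h₁ h₂
      (hviol.imp And.right (Or.imp_right And.right))
  · rw [max_eq_right h, min_eq_left h] at hviol
    refine fun hC => estimate_fails_of_le hd h₀ h₂ h₁ ?_ (estimate_swap hC)
    rw [add_comm α₂ α₁]
    exact hviol.imp And.right (Or.imp_right And.right)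
end
end
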